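/- Let μ̃ ≪ μ be probability measures on a Polish space and p̃(x,·) ≪ p(x,·) Markov kernels (μ̃-a.e. x), with μ̃* invariant for p̃. Then for the continuous-time pure-jump processes with jump rate λ > 0 and embedded chains p̃ and p started at μ̃* and μ respectively, the relative entropy of path measures up to time t satisfies R(P̃^{μ̃*}|_{𝓕_t} ‖ P^{μ}|_{𝓕_t}) ≤ R(μ̃*‖μ) + λt ∫ R(p̃(x,·)‖p(x,·)) dμ̃*(x). -/

import Mathlib

open MeasureTheory ProbabilityTheory ENNReal Classical

/-- Kullback–Leibler divergence. -/
noncomputable def relEnt {Ω : Type*} [MeasurableSpace Ω] (ν μ : Measure Ω) : ℝ≥0∞ :=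
  if ν ≪ μ ∧ Integrable (fun x => Real.log (ν.rnDeriv μ x).toReal) ν then
    ENNReal.ofReal (∫ x, Real.log (ν.rnDeriv μ x).toReal ∂ν)
  else ⊤

/-- The `n`-step path measure of a Markov chain with initial distribution `μ` and
one-step transition kernel `p`. -/
noncomputable def pathMeasure {𝒳 : Type*} [MeasurableSpace 𝒳] (μ : Measure 𝒳)
    (p : Kernel 𝒳 𝒳) : (n : ℕ) → Measure (Fin (n + 1) → 𝒳)
  | 0 => μ.map (fun x => fun _ => x)
  | n + 1 => (pathMeasure μ p n).bind
      (fun ω => (p (ω (Fin.last n))).map (fun y => Fin.snoc ω y))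

/-- Jump times: `J n ω` is the sum of the first `n` holding times. -/
noncomputable def jumpTime {𝒳 : Type*} (n : ℕ) (ω : ℕ → 𝒳 × ℝ) : ℝ :=
  ∑ k ∈ Finset.range n, (ω k).2

/-- The pure-jump process: `X t ω` is the chain state at the last jump before time `t`. -/
noncomputable def jumpProc {𝒳 : Type*} (t : ℝ) (ω : ℕ → 𝒳 × ℝ) : 𝒳 :=
  (ω (sSup {n : ℕ | jumpTime n ω ≤ t})).1

/-- The transition kernel of the embedded jump chain on `𝒳 × (0,∞)`:
`p^J((x,s),·) = p(x,dy) × Exp(lam)`. -/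
noncomputable def jumpKernel {𝒳 : Type*} [MeasurableSpace 𝒳] (lam : ℝ)
    (p : Kernel 𝒳 𝒳) [IsSFiniteKernel p] : Kernel (𝒳 × ℝ) (𝒳 × ℝ) :=
  (p.comap Prod.fst measurable_fst) ×ₖ (Kernel.const (𝒳 × ℝ) (ProbabilityTheory.expMeasure lam))

section JumpHelpers

set_option linter.unusedSectionVars false

lemma aux_measurable_snoc {E : Type*} [MeasurableSpace E] (n : ℕ) :
    Measurable (fun q : (Fin (n + 1) → E) × E => (Fin.snoc q.1 q.2 : Fin (n + 2) → E)) := by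
  refine measurable_pi_iff.2 fun i => ?_
  refine Fin.lastCases ?_ (fun j => ?_) i
  · simpa using measurable_snd
  · simpa [Function.comp_def] using (measurable_pi_apply j).comp measurable_fst

lemma aux_measurable_step {E : Type*} [MeasurableSpace E] (κ : Kernel E E) [IsMarkovKernel κ]
    (n : ℕ) :
    Measurable (fun v : Fin (n + 1) → E =>
      (κ (v (Fin.last n))).map (fun y => (Fin.snoc v y : Fin (n + 2) → E))) := by
  refine Measure.measurable_of_measurable_coe _ fun s hs => ?_
  have hm : ∀ v : Fin (n + 1) → E, Measurable (fun y => (Fin.snoc v y : Fin (n + 2) → E)) :=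
    fun v => (aux_measurable_snoc n).comp (measurable_const.prodMk measurable_id)
  simp_rw [fun v => Measure.map_apply (μ := κ (v (Fin.last n))) (hm v) hs]
  exact Kernel.measurable_kernel_prodMk_left
    (κ := κ.comap (fun v : Fin (n + 1) → E => v (Fin.last n)) (measurable_pi_apply _))
    ((aux_measurable_snoc n) hs)

/-- extend a finite path to an infinite one -/
def auxExt {E : Type*} (n : ℕ) (v : Fin (n + 1) → E) : ℕ → E :=
  fun k => v ⟨min k n, by omega⟩

lemma aux_measurable_ext {E : Type*} [MeasurableSpace E] (n : ℕ) :
    Measurable (auxExt n : (Fin (n + 1) → E) → ℕ → E) :=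
  measurable_pi_iff.2 fun _ => measurable_pi_apply _

lemma aux_measurable_res {E : Type*} [MeasurableSpace E] (n : ℕ) :
    Measurable (fun (ω : ℕ → E) (i : Fin (n + 1)) => ω i) :=
  measurable_pi_iff.2 fun _ => measurable_pi_apply _

lemma aux_init {E : Type*} [MeasurableSpace E] (ν : Measure E) (κ : Kernel E E)
    (P : Measure (ℕ → E))
    (HP : ∀ n : ℕ, P.map (fun ω (i : Fin (n + 1)) => ω i) = pathMeasure ν κ n)
    (F : (ℕ → E) → ℝ≥0∞) (hF : Measurable F)
    (hd : ∀ ω ω' : ℕ → E, (∀ i ≤ 0, ω i = ω' i) → F ω = F ω') :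
    ∫⁻ ω, F ω ∂P = ∫⁻ x, F (fun _ => x) ∂ν := by
  have hFe : Measurable (fun v : Fin (0 + 1) → E => F (auxExt 0 v)) :=
    hF.comp (aux_measurable_ext 0)
  have h1 : ∫⁻ ω, F ω ∂P = ∫⁻ v, F (auxExt 0 v) ∂(P.map (fun ω (i : Fin (0 + 1)) => ω i)) := by
    rw [lintegral_map hFe (aux_measurable_res 0)]
    refine lintegral_congr fun ω => hd _ _ fun i hi => ?_
    simp [auxExt, Nat.le_zero.1 hi]
  rw [h1, HP 0, pathMeasure, lintegral_map hFe
    (measurable_pi_iff.2 fun _ => measurable_id')]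
  rfl

lemma aux_markov {E : Type*} [MeasurableSpace E] (ν : Measure E) (κ : Kernel E E)
    [IsMarkovKernel κ] (P : Measure (ℕ → E))
    (HP : ∀ n : ℕ, P.map (fun ω (i : Fin (n + 1)) => ω i) = pathMeasure ν κ n)
    (n : ℕ) (F : (ℕ → E) → ℝ≥0∞) (hF : Measurable F)
    (hd : ∀ ω ω' : ℕ → E, (∀ i ≤ n + 1, ω i = ω' i) → F ω = F ω') :
    ∫⁻ ω, F ω ∂P = ∫⁻ ω, ∫⁻ y, F (Function.update ω (n + 1) y) ∂(κ (ω n)) ∂P := by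
  have hFe : Measurable (fun v : Fin (n + 1 + 1) → E => F (auxExt (n + 1) v)) :=
    hF.comp (aux_measurable_ext (n + 1))
  have h1 : ∫⁻ ω, F ω ∂P
      = ∫⁻ v, F (auxExt (n + 1) v) ∂(P.map (fun ω (i : Fin (n + 1 + 1)) => ω i)) := by
    rw [lintegral_map hFe (aux_measurable_res (n + 1))]
    refine lintegral_congr fun ω => hd _ _ fun i hi => ?_
    simp [auxExt, hi]
  rw [h1, HP (n + 1), pathMeasure,
    Measure.lintegral_bind (aux_measurable_step κ n).aemeasurable hFe.aemeasurable, ← HP n]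
  have hFi : Measurable (fun v : Fin (n + 1) → E => ∫⁻ x, F (auxExt (n + 1) x)
      ∂((κ (v (Fin.last n))).map (fun y => (Fin.snoc v y : Fin (n + 2) → E)))) :=
    (Measure.measurable_lintegral hFe).comp (aux_measurable_step κ n)
  rw [lintegral_map hFi (aux_measurable_res n)]
  refine lintegral_congr fun ω => ?_
  have hm : Measurable (fun y => (Fin.snoc (fun i : Fin (n + 1) => ω i) y : Fin (n + 2) → E)) := by
    have := (aux_measurable_snoc (E := E) n).comp
      ((measurable_const (a := fun i : Fin (n + 1) => ω i)).prodMk measurable_id)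
    exact this
  rw [lintegral_map hFe hm]
  simp only [Fin.val_last]
  refine lintegral_congr fun y => hd _ _ fun i hi => ?_
  rcases Nat.lt_or_ge i (n + 1) with h | h
  · have : i ≠ n + 1 := by omega
    simp [auxExt, Fin.snoc, this, hi, h]
  · have : i = n + 1 := by omega
    subst this
    simp [auxExt, Fin.snoc]

variable {𝒳 : Type*} [MeasurableSpace 𝒳]

lemma aux_jk (lam : ℝ) (hlam : 0 < lam) (p : Kernel 𝒳 𝒳) [IsMarkovKernel p] (x : 𝒳 × ℝ)
    (G : 𝒳 × ℝ → ℝ≥0∞) (hG : Measurable G) :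
    ∫⁻ y, G y ∂(jumpKernel lam p x) = ∫⁻ y, ∫⁻ s, G (y, s) ∂(expMeasure lam) ∂(p x.1) := by
  have := isProbabilityMeasure_expMeasure hlam
  rw [jumpKernel, Kernel.prod_apply, Kernel.comap_apply, Kernel.const_apply,
    lintegral_prod _ hG.aemeasurable]

lemma aux_jk_markov (lam : ℝ) (hlam : 0 < lam) (p : Kernel 𝒳 𝒳) [IsMarkovKernel p] :
    IsMarkovKernel (jumpKernel lam p) := by
  have := isProbabilityMeasure_expMeasure hlam
  unfold jumpKernel
  infer_instance

/-- Markov property for the jump chain -/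
lemma aux_jmarkov (lam : ℝ) (hlam : 0 < lam) (ν : Measure (𝒳 × ℝ)) (p : Kernel 𝒳 𝒳)
    [IsMarkovKernel p] (P : Measure (ℕ → 𝒳 × ℝ))
    (HP : ∀ n : ℕ, P.map (fun ω (i : Fin (n + 1)) => ω i) = pathMeasure ν (jumpKernel lam p) n)
    (n : ℕ) (F : (ℕ → 𝒳 × ℝ) → ℝ≥0∞) (hF : Measurable F)
    (hd : ∀ ω ω' : ℕ → 𝒳 × ℝ, (∀ i ≤ n + 1, ω i = ω' i) → F ω = F ω') :
    ∫⁻ ω, F ω ∂P = ∫⁻ ω, ∫⁻ y, ∫⁻ s, F (Function.update ω (n + 1) (y, s)) ∂(expMeasure lam)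
      ∂(p (ω n).1) ∂P := by
  have := aux_jk_markov lam hlam p
  rw [aux_markov ν _ P HP n F hF hd]
  refine lintegral_congr fun ω => ?_
  exact aux_jk lam hlam p _ _ (hF.comp (measurable_update ω))

/-- law of the `(n+1)`-st jump time -/
noncomputable def auxM (lam : ℝ) : ℕ → Measure ℝ
  | 0 => expMeasure lam
  | n + 1 => (auxM lam n).conv (expMeasure lam)

/-- marginals of the chain -/
noncomputable def auxNu (ν : Measure 𝒳) (p : Kernel 𝒳 𝒳) : ℕ → Measure 𝒳
  | 0 => ν
  | n + 1 => (auxNu ν p n).bind (fun x => p x)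

lemma auxM_prob (lam : ℝ) (hlam : 0 < lam) (n : ℕ) : IsProbabilityMeasure (auxM lam n) := by
  have := isProbabilityMeasure_expMeasure hlam
  induction n with
  | zero => exact this
  | succ n ih =>
    rw [auxM]
    infer_instance

lemma aux_meas_jumpTime (n : ℕ) : Measurable (fun ω : ℕ → 𝒳 × ℝ => jumpTime n ω) := by
  unfold jumpTime
  fun_prop

lemma aux_jumpTime_succ {𝒳 : Type*} (n : ℕ) (ω : ℕ → 𝒳 × ℝ) :
    jumpTime (n + 1) ω = jumpTime n ω + (ω n).2 := by
  simp [jumpTime, Finset.sum_range_succ]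

lemma aux_jumpTime_congr {𝒳 : Type*} (n : ℕ) (ω ω' : ℕ → 𝒳 × ℝ) (h : ∀ i < n, ω i = ω' i) :
    jumpTime n ω = jumpTime n ω' := by
  unfold jumpTime
  exact Finset.sum_congr rfl fun i hi => by rw [h i (Finset.mem_range.1 hi)]

lemma aux_law (lam : ℝ) (hlam : 0 < lam) (ν : Measure 𝒳) [IsProbabilityMeasure ν]
    (p : Kernel 𝒳 𝒳) [IsMarkovKernel p] (P : Measure (ℕ → 𝒳 × ℝ))
    (HP : ∀ n : ℕ, P.map (fun ω (i : Fin (n + 1)) => ω i) =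
      pathMeasure (ν.prod (expMeasure lam)) (jumpKernel lam p) n)
    (n : ℕ) (G : ℝ → ℝ≥0∞) (R : 𝒳 → ℝ≥0∞) (hG : Measurable G) (hR : Measurable R) :
    ∫⁻ ω, G (jumpTime (n + 1) ω) * R (ω n).1 ∂P
      = (∫⁻ s, G s ∂(auxM lam n)) * ∫⁻ x, R x ∂(auxNu ν p n) := by
  have := isProbabilityMeasure_expMeasure hlam
  induction n generalizing G R with
  | zero =>
    rw [aux_init _ _ P HP (fun ω => G (jumpTime (0 + 1) ω) * R (ω 0).1)]
    · simp only [jumpTime, auxM, auxNu, zero_add, Finset.range_one, Finset.sum_singleton]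
      rw [mul_comm, ← lintegral_prod_mul hR.aemeasurable hG.aemeasurable]
      exact lintegral_congr fun x => mul_comm _ _
    · exact (hG.comp (aux_meas_jumpTime _)).mul
        (hR.comp (measurable_fst.comp (measurable_pi_apply 0)))
    · intro ω ω' h
      rw [aux_jumpTime_congr _ ω ω' (fun i hi => h i (by omega)), h 0 le_rfl]
  | succ n ih =>
    rw [aux_jmarkov lam hlam _ p P HP n (fun ω => G (jumpTime (n + 1 + 1) ω) * R (ω (n + 1)).1)]
    · have hG' : Measurable (fun u : ℝ => ∫⁻ s, G (u + s) ∂(expMeasure lam)) :=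
        Measurable.lintegral_prod_right' (f := fun q : ℝ × ℝ => G (q.1 + q.2))
          (hG.comp measurable_add)
      have hR' : Measurable (fun x => ∫⁻ y, R y ∂(p x)) := hR.lintegral_kernel
      have key : ∀ ω : ℕ → 𝒳 × ℝ, (∫⁻ y, ∫⁻ s, G (jumpTime (n + 1 + 1)
            (Function.update ω (n + 1) (y, s))) * R (Function.update ω (n + 1) (y, s) (n + 1)).1
            ∂(expMeasure lam) ∂(p (ω n).1))
          = (∫⁻ s, G (jumpTime (n + 1) ω + s) ∂(expMeasure lam)) * ∫⁻ y, R y ∂(p (ω n).1) := by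
        intro ω
        rw [← lintegral_const_mul _ hR]
        refine lintegral_congr fun y => ?_
        rw [← lintegral_mul_const _ (show Measurable fun s => G (jumpTime (n + 1) ω + s) from
          hG.comp (measurable_const_add _))]
        refine lintegral_congr fun s => ?_
        rw [aux_jumpTime_succ, aux_jumpTime_congr (n + 1) (Function.update ω (n + 1) (y, s)) ω]
        · simp
        · intro i hi
          rw [Function.update_of_ne (by omega)]
      simp_rw [key]
      rw [ih _ _ hG' hR', auxM, auxNu, Measure.lintegral_conv hG,
        Measure.lintegral_bind p.measurable.aemeasurable hR.aemeasurable]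
    · exact (hG.comp (aux_meas_jumpTime _)).mul
        (hR.comp (measurable_fst.comp (measurable_pi_apply _)))
    · intro ω ω' h
      rw [aux_jumpTime_congr _ ω ω' (fun i hi => h i (by omega)), h _ le_rfl]

lemma aux_exp_withDensity (lam : ℝ) :
    expMeasure lam = volume.withDensity (exponentialPDF lam) := rfl

lemma aux_exp_int (lam : ℝ) (hlam : 0 < lam) (t : ℝ) :
    ∫⁻ s, (ENNReal.ofReal (lam * (t - s)) + (Set.Iic t).indicator 1 s) ∂(expMeasure lam)
      ≤ ENNReal.ofReal (lam * t) := by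
  have hpm : Measurable (exponentialPDF lam) := by
    unfold exponentialPDF
    fun_prop
  rw [aux_exp_withDensity, lintegral_withDensity_eq_lintegral_mul _ hpm
    (by fun_prop (disch := exact measurableSet_Iic))]
  have h1 : ∀ s, (exponentialPDF lam * fun s => (ENNReal.ofReal (lam * (t - s))
      + (Set.Iic t).indicator 1 s)) s = (Set.Icc 0 t).indicator
        (fun s => ENNReal.ofReal ((lam * (t - s) + 1) * (lam * Real.exp (-(lam * s))))) s := by
    intro s
    simp only [Pi.mul_apply]
    by_cases h0 : 0 ≤ s
    · by_cases hst : s ≤ t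
      · have : 0 ≤ lam * (t - s) := mul_nonneg hlam.le (by linarith)
        rw [Set.indicator_of_mem (show s ∈ Set.Iic t from hst),
          Set.indicator_of_mem (show s ∈ Set.Icc 0 t from ⟨h0, hst⟩),
          exponentialPDF_of_nonneg h0, ENNReal.ofReal_mul (p := lam * (t - s) + 1) (by linarith),
          ENNReal.ofReal_add this zero_le_one, mul_comm]
        simp
      · have : lam * (t - s) ≤ 0 := mul_nonpos_of_nonneg_of_nonpos hlam.le (by linarith)
        rw [Set.indicator_of_notMem (show s ∉ Set.Iic t from hst),
          Set.indicator_of_notMem (show s ∉ Set.Icc 0 t from fun h => hst h.2),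
          ENNReal.ofReal_of_nonpos this]
        simp
    · rw [exponentialPDF_of_neg (by linarith),
        Set.indicator_of_notMem (show s ∉ Set.Icc 0 t from fun h => h0 h.1), zero_mul]
  rw [lintegral_congr h1, lintegral_indicator measurableSet_Icc]
  rcases lt_or_ge t 0 with ht | ht
  · simp [Set.Icc_eq_empty (not_le.2 ht)]
  have hcont : Continuous (fun s => (lam * (t - s) + 1) * (lam * Real.exp (-(lam * s)))) := by
    fun_prop
  rw [← ofReal_integral_eq_lintegral_ofReal (hcont.integrableOn_Icc)]
  · rw [integral_Icc_eq_integral_Ioc, ← intervalIntegral.integral_of_le ht]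
    have hder : ∀ s ∈ Set.uIcc 0 t, HasDerivAt (fun s => -(lam * (t - s)) * Real.exp (-(lam * s)))
        ((lam * (t - s) + 1) * (lam * Real.exp (-(lam * s)))) s := by
      intro s _
      have e1 : HasDerivAt (fun s => -(lam * (t - s))) lam s := by
        have := (((hasDerivAt_id s).const_sub t).const_mul lam).neg
        exact this.congr_deriv (by simp)
      have e2 : HasDerivAt (fun s => Real.exp (-(lam * s)))
          (Real.exp (-(lam * s)) * (-(lam * 1))) s :=
        (((hasDerivAt_id s).const_mul lam).neg).exp
      exact (e1.mul e2).congr_deriv (by ring)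
    rw [intervalIntegral.integral_eq_sub_of_hasDerivAt hder (hcont.intervalIntegrable _ _)]
    simp
  · rw [Filter.EventuallyLE, ae_restrict_iff' measurableSet_Icc]
    refine Filter.Eventually.of_forall fun s hs => ?_
    have : 0 ≤ lam * (t - s) := mul_nonneg hlam.le (by linarith [hs.2])
    simp only [Pi.zero_apply]
    positivity

lemma aux_renewal (lam : ℝ) (hlam : 0 < lam) (n : ℕ) (t : ℝ) :
    ∑ k ∈ Finset.range n, auxM lam k (Set.Iic t) ≤ ENNReal.ofReal (lam * t) := by
  have := isProbabilityMeasure_expMeasure hlam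
  induction n generalizing t with
  | zero => simp
  | succ n ih =>
    rw [Finset.sum_range_succ']
    have hk : ∀ k, auxM lam (k + 1) (Set.Iic t)
        = ∫⁻ s, auxM lam k (Set.Iic (t - s)) ∂(expMeasure lam) := by
      intro k
      have := auxM_prob lam hlam k
      rw [auxM, Measure.conv_comm, ← lintegral_indicator_one measurableSet_Iic,
        Measure.lintegral_conv (measurable_one.indicator measurableSet_Iic)]
      refine lintegral_congr fun s => ?_
      rw [← lintegral_indicator_one measurableSet_Iic]
      refine lintegral_congr fun u => ?_
      simp only [Set.indicator, Set.mem_Iic]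
      congr 1
      exact propext ⟨fun h => by linarith, fun h => by linarith⟩
    have hm : ∀ k, Measurable (fun s => auxM lam k (Set.Iic (t - s))) := by
      intro k
      have : Antitone (fun s => auxM lam k (Set.Iic (t - s))) := fun a b hab =>
        measure_mono (Set.Iic_subset_Iic.2 (by linarith))
      exact this.measurable
    simp_rw [hk]
    rw [← lintegral_finsetSum _ (fun k _ => hm k)]
    refine le_trans ?_ (aux_exp_int lam hlam t)
    rw [lintegral_add_left (by fun_prop), lintegral_indicator_one measurableSet_Iic]
    exact add_le_add (lintegral_mono fun s => ih (t - s)) le_rfl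

lemma aux_exp_zero (lam : ℝ) (hlam : 0 < lam) : expMeasure lam (Set.Iic 0) = 0 := by
  have := aux_renewal lam hlam 1 0
  simpa [auxM] using this

lemma auxNu_prob (ν : Measure 𝒳) [IsProbabilityMeasure ν] (p : Kernel 𝒳 𝒳) [IsMarkovKernel p]
    (n : ℕ) : IsProbabilityMeasure (auxNu ν p n) := by
  induction n with
  | zero => assumption
  | succ n ih =>
    rw [auxNu]
    exact (inferInstance : IsProbabilityMeasure ((auxNu ν p n).bind p))

lemma aux_pos (lam : ℝ) (hlam : 0 < lam) (ν : Measure 𝒳) [IsProbabilityMeasure ν]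
    (p : Kernel 𝒳 𝒳) [IsMarkovKernel p] (P : Measure (ℕ → 𝒳 × ℝ))
    (HP : ∀ n : ℕ, P.map (fun ω (i : Fin (n + 1)) => ω i) =
      pathMeasure (ν.prod (expMeasure lam)) (jumpKernel lam p) n) :
    ∀ᵐ ω ∂P, ∀ k, 0 < (ω k).2 := by
  have := isProbabilityMeasure_expMeasure hlam
  rw [ae_all_iff]
  intro k
  have hI : Measurable ((Set.Iic (0 : ℝ)).indicator (1 : ℝ → ℝ≥0∞)) :=
    measurable_one.indicator measurableSet_Iic
  have hFm : Measurable (fun ω : ℕ → 𝒳 × ℝ =>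
      (Set.Iic (0 : ℝ)).indicator (1 : ℝ → ℝ≥0∞) (ω k).2) :=
    hI.comp (measurable_snd.comp (measurable_pi_apply k))
  have h0 : ∫⁻ s, (Set.Iic (0 : ℝ)).indicator (1 : ℝ → ℝ≥0∞) s ∂(expMeasure lam) = 0 := by
    rw [lintegral_indicator_one measurableSet_Iic, aux_exp_zero lam hlam]
  have h1 : ∫⁻ ω, (Set.Iic (0 : ℝ)).indicator (1 : ℝ → ℝ≥0∞) (ω k).2 ∂P = 0 := by
    cases k with
    | zero =>
      rw [aux_init _ _ P HP _ hFm (fun ω ω' h => by rw [h 0 le_rfl]),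
        lintegral_prod _ (show Measurable fun x : 𝒳 × ℝ =>
          (Set.Iic (0 : ℝ)).indicator (1 : ℝ → ℝ≥0∞) x.2 from hI.comp measurable_snd).aemeasurable]
      simp [h0]
    | succ n =>
      rw [aux_jmarkov lam hlam _ p P HP n _ hFm (fun ω ω' h => by rw [h _ le_rfl])]
      simp [h0]
  rw [lintegral_eq_zero_iff hFm] at h1
  filter_upwards [h1] with ω hω
  by_contra hc
  rw [Set.indicator_of_mem (show (ω k).2 ∈ Set.Iic (0 : ℝ) from not_lt.1 hc)] at hω
  simp at hω

lemma aux_finite (lam : ℝ) (hlam : 0 < lam) (ν : Measure 𝒳) [IsProbabilityMeasure ν]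
    (p : Kernel 𝒳 𝒳) [IsMarkovKernel p] (P : Measure (ℕ → 𝒳 × ℝ))
    (HP : ∀ n : ℕ, P.map (fun ω (i : Fin (n + 1)) => ω i) =
      pathMeasure (ν.prod (expMeasure lam)) (jumpKernel lam p) n) (t : ℝ) :
    ∀ᵐ ω ∂P, ∃ n, t < jumpTime (n + 1) ω := by
  have hk : ∀ k, P {ω | jumpTime (k + 1) ω ≤ t} = auxM lam k (Set.Iic t) := by
    intro k
    have := auxNu_prob ν p k
    have h := aux_law lam hlam ν p P HP k ((Set.Iic t).indicator 1) (fun _ => 1)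
      (measurable_one.indicator measurableSet_Iic) measurable_const
    simp only [mul_one, lintegral_one, measure_univ,
      lintegral_indicator_one measurableSet_Iic] at h
    rw [← h, ← lintegral_indicator_one (measurableSet_le (aux_meas_jumpTime _) measurable_const)]
    rfl
  have hs : ∑' k, P {ω | jumpTime (k + 1) ω ≤ t} ≠ ∞ := by
    simp_rw [hk]
    exact ne_top_of_le_ne_top ENNReal.ofReal_ne_top
      (ENNReal.tsum_le_of_sum_range_le fun n => aux_renewal lam hlam n t)
  filter_upwards [ae_eventually_notMem hs] with ω hω
  obtain ⟨n, hn⟩ := hω.exists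
  exact ⟨n, not_le.1 hn⟩

section densities

variable (f0 : 𝒳 → NNReal) (h : 𝒳 → 𝒳 → NNReal)

/-- density of the first `n+1` steps -/
noncomputable def auxf (n : ℕ) (ω : ℕ → 𝒳 × ℝ) : NNReal :=
  f0 (ω 0).1 * ∏ k ∈ Finset.range n, h (ω k).1 (ω (k + 1)).1

/-- density of the first `n+1` steps, frozen after time `t` -/
noncomputable def auxg (t : ℝ) (n : ℕ) (ω : ℕ → 𝒳 × ℝ) : NNReal :=
  f0 (ω 0).1 * ∏ k ∈ Finset.range n,
    if jumpTime (k + 1) ω ≤ t then h (ω k).1 (ω (k + 1)).1 else 1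

lemma auxf_meas (hf0 : Measurable f0) (hh : Measurable (Function.uncurry h)) (n : ℕ) :
    Measurable (auxf f0 h n) := by
  have h1 : ∀ k : ℕ, Measurable (fun ω : ℕ → 𝒳 × ℝ => h (ω k).1 (ω (k + 1)).1) := fun k =>
    hh.comp (f := fun ω : ℕ → 𝒳 × ℝ => ((ω k).1, (ω (k + 1)).1)) (by fun_prop)
  unfold auxf
  exact (hf0.comp (by fun_prop)).mul (Finset.measurable_fun_prod _ fun k _ => h1 k)

lemma auxg_meas (hf0 : Measurable f0) (hh : Measurable (Function.uncurry h)) (t : ℝ) (n : ℕ) :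
    Measurable (auxg f0 h t n) := by
  have h1 : ∀ k : ℕ, Measurable (fun ω : ℕ → 𝒳 × ℝ => h (ω k).1 (ω (k + 1)).1) := fun k =>
    hh.comp (f := fun ω : ℕ → 𝒳 × ℝ => ((ω k).1, (ω (k + 1)).1)) (by fun_prop)
  unfold auxg
  exact (hf0.comp (by fun_prop)).mul (Finset.measurable_fun_prod _ fun k _ =>
    Measurable.ite (measurableSet_le (aux_meas_jumpTime _) measurable_const) (h1 k)
      measurable_const)

lemma auxf_congr (n : ℕ) (ω ω' : ℕ → 𝒳 × ℝ) (hω : ∀ i ≤ n, ω i = ω' i) :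
    auxf f0 h n ω = auxf f0 h n ω' := by
  unfold auxf
  rw [hω 0 (by omega)]
  congr 1
  refine Finset.prod_congr rfl fun k hk => ?_
  rw [Finset.mem_range] at hk
  rw [hω k (by omega), hω (k + 1) (by omega)]

lemma auxg_congr (t : ℝ) (n : ℕ) (ω ω' : ℕ → 𝒳 × ℝ) (hω : ∀ i ≤ n, ω i = ω' i) :
    auxg f0 h t n ω = auxg f0 h t n ω' := by
  unfold auxg
  rw [hω 0 (by omega)]
  congr 1
  refine Finset.prod_congr rfl fun k hk => ?_
  rw [Finset.mem_range] at hk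
  rw [hω k (by omega), hω (k + 1) (by omega),
    aux_jumpTime_congr (k + 1) ω ω' (fun i hi => hω i (by omega))]

lemma auxf_update (n : ℕ) (ω : ℕ → 𝒳 × ℝ) (y : 𝒳 × ℝ) :
    auxf f0 h (n + 1) (Function.update ω (n + 1) y) = auxf f0 h n ω * h (ω n).1 y.1 := by
  have e : auxf f0 h (n + 1) (Function.update ω (n + 1) y)
    = auxf f0 h n (Function.update ω (n + 1) y) * h (Function.update ω (n + 1) y n).1
      (Function.update ω (n + 1) y (n + 1)).1 := by
    unfold auxf
    rw [Finset.prod_range_succ, mul_assoc]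
  rw [e, auxf_congr f0 h n _ ω (fun i hi => Function.update_of_ne (by omega) _ _),
    Function.update_of_ne (by omega), Function.update_self]

lemma auxg_update (t : ℝ) (n : ℕ) (ω : ℕ → 𝒳 × ℝ) (y : 𝒳 × ℝ) :
    auxg f0 h t (n + 1) (Function.update ω (n + 1) y)
      = auxg f0 h t n ω * if jumpTime (n + 1) ω ≤ t then h (ω n).1 y.1 else 1 := by
  have e : auxg f0 h t (n + 1) (Function.update ω (n + 1) y)
    = auxg f0 h t n (Function.update ω (n + 1) y) *
      if jumpTime (n + 1) (Function.update ω (n + 1) y) ≤ t then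
        h (Function.update ω (n + 1) y n).1 (Function.update ω (n + 1) y (n + 1)).1 else 1 := by
    unfold auxg
    rw [Finset.prod_range_succ, mul_assoc]
  rw [e, auxg_congr f0 h t n _ ω (fun i hi => Function.update_of_ne (by omega) _ _),
    Function.update_of_ne (by omega), Function.update_self,
    aux_jumpTime_congr (n + 1) _ ω (fun i hi => Function.update_of_ne (by omega) _ _)]

lemma aux_meas_update (n : ℕ) : Measurable (fun q : (ℕ → 𝒳 × ℝ) × (𝒳 × ℝ) =>
    Function.update q.1 n q.2) := by
  refine measurable_pi_iff.2 fun i => ?_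
  by_cases hi : i = n
  · subst hi
    simpa using measurable_snd
  · simp only [Function.update_of_ne hi]
    fun_prop

lemma aux_inner_meas (lam : ℝ) (hlam : 0 < lam) (p : Kernel 𝒳 𝒳) [IsMarkovKernel p] (n : ℕ)
    (K : (ℕ → 𝒳 × ℝ) × (𝒳 × ℝ) → ℝ≥0∞) (hK : Measurable K) :
    Measurable (fun ω : ℕ → 𝒳 × ℝ =>
      ∫⁻ y, ∫⁻ s, K (ω, (y, s)) ∂(expMeasure lam) ∂(p (ω n).1)) := by
  have := isProbabilityMeasure_expMeasure hlam
  have h1 : Measurable (fun q : (ℕ → 𝒳 × ℝ) × 𝒳 =>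
      ∫⁻ s, K (q.1, (q.2, s)) ∂(expMeasure lam)) :=
    Measurable.lintegral_prod_right' (f := fun q : ((ℕ → 𝒳 × ℝ) × 𝒳) × ℝ => K (q.1.1, (q.1.2, q.2)))
      (hK.comp (by fun_prop))
  exact Measurable.lintegral_kernel_prod_right'
    (κ := p.comap (fun ω : ℕ → 𝒳 × ℝ => (ω n).1) (by fun_prop)) h1

lemma aux_change (lam : ℝ) (hlam : 0 < lam) (μ mustar : Measure 𝒳) [IsProbabilityMeasure μ]
    [IsProbabilityMeasure mustar] (p ptilde : Kernel 𝒳 𝒳) [IsMarkovKernel p]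
    [IsMarkovKernel ptilde]
    (hf0m : Measurable f0) (hh : Measurable (Function.uncurry h))
    (hf0 : mustar = μ.withDensity (fun x => (f0 x : ℝ≥0∞)))
    (hae : ∀ᵐ x ∂mustar, ptilde x = (p x).withDensity (fun y => (h x y : ℝ≥0∞)))
    (hnu : ∀ n, auxNu mustar ptilde n = mustar)
    (Pμ Pmustar : Measure (ℕ → 𝒳 × ℝ))
    (HP : ∀ n : ℕ, Pμ.map (fun ω (i : Fin (n + 1)) => ω i) =
      pathMeasure (μ.prod (expMeasure lam)) (jumpKernel lam p) n)
    (HPt : ∀ n : ℕ, Pmustar.map (fun ω (i : Fin (n + 1)) => ω i) =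
      pathMeasure (mustar.prod (expMeasure lam)) (jumpKernel lam ptilde) n)
    (n : ℕ) (F : (ℕ → 𝒳 × ℝ) → ℝ≥0∞) (hF : Measurable F)
    (hd : ∀ ω ω' : ℕ → 𝒳 × ℝ, (∀ i ≤ n, ω i = ω' i) → F ω = F ω') :
    ∫⁻ ω, F ω ∂Pmustar = ∫⁻ ω, auxf f0 h n ω * F ω ∂Pμ := by
  have := isProbabilityMeasure_expMeasure hlam
  have hfm := auxf_meas f0 h hf0m hh
  induction n generalizing F with
  | zero =>
    have hc : Measurable (fun x : 𝒳 × ℝ => F (fun _ => x)) :=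
      hF.comp (measurable_pi_iff.2 fun _ => measurable_id')
    rw [aux_init _ _ Pmustar HPt F hF hd, aux_init _ _ Pμ HP (fun ω => auxf f0 h 0 ω * F ω)
      ((hfm 0).coe_nnreal_ennreal.mul hF)
      (fun ω ω' h' => by rw [hd ω ω' h', auxf_congr f0 h 0 ω ω' h']),
      lintegral_prod _ hc.aemeasurable, lintegral_prod, hf0,
      lintegral_withDensity_eq_lintegral_mul _ hf0m.coe_nnreal_ennreal hc.lintegral_prod_right']
    · refine lintegral_congr fun x => ?_
      rw [Pi.mul_apply, ← lintegral_const_mul _ (show Measurable fun s : ℝ => F (fun _ => (x, s)) from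
        hc.comp (f := fun s : ℝ => (x, s)) (by fun_prop))]
      simp [auxf]
    · refine Measurable.aemeasurable (Measurable.mul ?_ hc)
      exact (hfm 0).coe_nnreal_ennreal.comp (measurable_pi_iff.2 fun _ => measurable_id')
  | succ n ih =>
    have hmap : Pmustar.map (fun ω : ℕ → 𝒳 × ℝ => (ω n).1) = mustar := by
      ext s hs
      have hl := aux_law lam hlam mustar ptilde Pmustar HPt n (fun _ => 1) (s.indicator 1)
        measurable_const (measurable_one.indicator hs)
      have := auxM_prob lam hlam n
      rw [hnu n] at hl
      simp only [one_mul, lintegral_one, measure_univ, lintegral_indicator_one hs] at hl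
      rw [← hl, Measure.map_apply (by fun_prop) hs, ← lintegral_indicator_one]
      · rfl
      · exact (measurable_fst.comp (measurable_pi_apply n)) hs
    have hae' : ∀ᵐ ω ∂Pmustar,
        ptilde (ω n).1 = (p (ω n).1).withDensity (fun y => (h (ω n).1 y : ℝ≥0∞)) := by
      rw [← hmap] at hae
      exact ae_of_ae_map (measurable_fst.comp (measurable_pi_apply n)).aemeasurable hae
    have hFu : Measurable (fun q : (ℕ → 𝒳 × ℝ) × (𝒳 × ℝ) => F (Function.update q.1 (n + 1) q.2)) :=
      hF.comp (aux_meas_update (n + 1))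
    have hhu : Measurable (fun q : (ℕ → 𝒳 × ℝ) × (𝒳 × ℝ) => (h (q.1 n).1 q.2.1 : ℝ≥0∞)) :=
      (hh.comp (f := fun q : (ℕ → 𝒳 × ℝ) × (𝒳 × ℝ) => ((q.1 n).1, q.2.1))
        (by fun_prop)).coe_nnreal_ennreal
    have hFy : ∀ ω, Measurable fun q : 𝒳 × ℝ => F (Function.update ω (n + 1) q) := fun ω =>
      hFu.comp (measurable_const.prodMk measurable_id)
    have hhy : ∀ x, Measurable (fun y => (h x y : ℝ≥0∞)) := fun x =>
      (hh.comp (f := fun y => (x, y)) (by fun_prop)).coe_nnreal_ennreal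
    rw [aux_jmarkov lam hlam _ ptilde Pmustar HPt n F hF hd,
      aux_jmarkov lam hlam _ p Pμ HP n (fun ω => auxf f0 h (n + 1) ω * F ω)
      ((hfm _).coe_nnreal_ennreal.mul hF)
      (fun ω ω' h' => by rw [hd ω ω' h', auxf_congr f0 h (n + 1) ω ω' h'])]
    have e1 : ∫⁻ ω, ∫⁻ y, ∫⁻ s, F (Function.update ω (n + 1) (y, s)) ∂(expMeasure lam)
        ∂(ptilde (ω n).1) ∂Pmustar
        = ∫⁻ ω, ∫⁻ y, ∫⁻ s, (h (ω n).1 y : ℝ≥0∞) * F (Function.update ω (n + 1) (y, s))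
          ∂(expMeasure lam) ∂(p (ω n).1) ∂Pmustar := by
      refine lintegral_congr_ae ?_
      filter_upwards [hae'] with ω hω
      rw [hω, lintegral_withDensity_eq_lintegral_mul _ (hhy _) (hFy ω).lintegral_prod_right']
      refine lintegral_congr fun y => ?_
      rw [Pi.mul_apply, ← lintegral_const_mul]
      exact (hFy ω).comp (by fun_prop)
    have hmK : Measurable (fun ω : ℕ → 𝒳 × ℝ => ∫⁻ y, ∫⁻ s, (h (ω n).1 y : ℝ≥0∞) *
        F (Function.update ω (n + 1) (y, s)) ∂(expMeasure lam) ∂(p (ω n).1)) :=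
      aux_inner_meas lam hlam p n _ (hhu.mul hFu)
    rw [e1, ih _ hmK]
    · refine lintegral_congr fun ω => ?_
      have hm2 : Measurable (fun q : 𝒳 × ℝ =>
          (h (ω n).1 q.1 : ℝ≥0∞) * F (Function.update ω (n + 1) q)) :=
        ((hhy _).comp measurable_fst).mul (hFy ω)
      rw [← lintegral_const_mul _ hm2.lintegral_prod_right']
      refine lintegral_congr fun y => ?_
      rw [← lintegral_const_mul _ (show Measurable fun s : ℝ =>
        (h (ω n).1 y : ℝ≥0∞) * F (Function.update ω (n + 1) (y, s)) from
        hm2.comp (by fun_prop : Measurable fun s : ℝ => (y, s)))]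
      refine lintegral_congr fun s => ?_
      rw [auxf_update, ENNReal.coe_mul, mul_assoc]
    · intro ω ω' h'
      rw [h' n le_rfl]
      refine lintegral_congr fun y => lintegral_congr fun s => ?_
      congr 1
      refine hd _ _ fun i hi => ?_
      by_cases hin : i = n + 1
      · subst hin
        simp
      · rw [Function.update_of_ne hin, Function.update_of_ne hin, h' i (by omega)]

end densities

open InformationTheory in
lemma aux_relEnt_eq {Ω : Type*} [MeasurableSpace Ω] (ν μ : Measure Ω) [IsProbabilityMeasure ν]
    [IsProbabilityMeasure μ] : relEnt ν μ = klDiv ν μ := by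
  have hl : (fun x => Real.log (ν.rnDeriv μ x).toReal) = llr ν μ := rfl
  unfold relEnt
  rw [hl]
  split_ifs with hc
  · rw [klDiv_of_ac_of_integrable hc.1 hc.2]
    simp
  · symm
    rw [klDiv_eq_top_iff]
    exact fun h1 h2 => hc ⟨h1, h2⟩

open InformationTheory in
lemma aux_kl_wd {Ω : Type*} [MeasurableSpace Ω] (ν μ : Measure Ω) [IsFiniteMeasure ν]
    [IsFiniteMeasure μ] (k : Ω → NNReal) (hk : Measurable k)
    (hν : ν = μ.withDensity (fun x => (k x : ℝ≥0∞))) :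
    klDiv ν μ = ∫⁻ x, ENNReal.ofReal (klFun (k x)) ∂μ := by
  rw [klDiv_eq_lintegral_klFun_of_ac (hν ▸ withDensity_absolutelyContinuous _ _)]
  have := Measure.rnDeriv_withDensity μ hk.coe_nnreal_ennreal
  rw [← hν] at this
  refine lintegral_congr_ae ?_
  filter_upwards [this] with x hx
  rw [hx]
  simp

open InformationTheory in
lemma aux_kl_one {Ω : Type*} [MeasurableSpace Ω] (ρ : Measure Ω) [IsProbabilityMeasure ρ]
    (k : Ω → NNReal) (hk : Measurable k) (h1 : ∫⁻ y, (k y : ℝ≥0∞) ∂ρ = 1) (a : NNReal) :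
    ∫⁻ y, ENNReal.ofReal (klFun ((a * k y : NNReal) : ℝ)) ∂ρ
      = ENNReal.ofReal (klFun a) + a * ∫⁻ y, ENNReal.ofReal (klFun (k y)) ∂ρ := by
  have pt : ∀ b : NNReal, ENNReal.ofReal (klFun ((a * b : NNReal) : ℝ)) + (a + b)
      = a * ENNReal.ofReal (klFun b) + (b * ENNReal.ofReal (klFun a) + (1 + a * b)) := by
    intro b
    have na : 0 ≤ klFun (a : ℝ) := klFun_nonneg a.2
    have nb : 0 ≤ klFun (b : ℝ) := klFun_nonneg b.2
    have nab : 0 ≤ klFun ((a * b : NNReal) : ℝ) := klFun_nonneg (a * b).2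
    have ea : (a : ℝ≥0∞) = ENNReal.ofReal (a : ℝ) := by simp
    have eb : (b : ℝ≥0∞) = ENNReal.ofReal (b : ℝ) := by simp
    have pa : (0 : ℝ) ≤ a := a.2
    have pb : (0 : ℝ) ≤ b := b.2
    rw [ea, eb, ← ENNReal.ofReal_one, ← ENNReal.ofReal_mul pa, ← ENNReal.ofReal_mul pa,
      ← ENNReal.ofReal_mul pb, ← ENNReal.ofReal_add pa pb, ← ENNReal.ofReal_add nab (by positivity),
      ← ENNReal.ofReal_add zero_le_one (by positivity),
      ← ENNReal.ofReal_add (by positivity) (by positivity),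
      ← ENNReal.ofReal_add (by positivity) (by positivity)]
    congr 1
    rcases eq_or_ne a 0 with rfl | ha
    · simp [klFun]; ring
    rcases eq_or_ne b 0 with rfl | hb
    · simp [klFun]; ring
    simp only [klFun, NNReal.coe_mul]
    rw [Real.log_mul (by exact_mod_cast ha) (by exact_mod_cast hb)]
    ring
  have m1 : Measurable fun y => ENNReal.ofReal (klFun ((a * k y : NNReal) : ℝ)) :=
    (measurable_klFun.comp (measurable_const.mul hk).coe_nnreal_real).ennreal_ofReal
  have m2 : Measurable fun y => ENNReal.ofReal (klFun (k y : ℝ)) :=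
    (measurable_klFun.comp hk.coe_nnreal_real).ennreal_ofReal
  have hk' := hk.coe_nnreal_ennreal
  have hi := lintegral_congr (μ := ρ) (fun y => pt (k y))
  rw [lintegral_add_left m1, lintegral_add_left (by fun_prop), lintegral_add_left (by fun_prop),
    lintegral_add_left (by fun_prop), lintegral_add_left (by fun_prop), lintegral_const_mul _ m2,
    lintegral_mul_const _ hk', lintegral_const_mul _ hk', h1] at hi
  simp only [lintegral_const, measure_univ, mul_one, one_mul] at hi
  have hfin : (1 + a : ℝ≥0∞) ≠ ∞ := by simp
  rw [← ENNReal.add_left_inj hfin, add_comm (1 : ℝ≥0∞) a, hi]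
  rw [add_comm (1 : ℝ≥0∞) a]
  ring

open InformationTheory in
lemma aux_kl_step (f0 : 𝒳 → NNReal) (h : 𝒳 → 𝒳 → NNReal) (lam : ℝ) (hlam : 0 < lam)
    (μ : Measure 𝒳) [IsProbabilityMeasure μ] (p : Kernel 𝒳 𝒳) [IsMarkovKernel p]
    (hf0m : Measurable f0) (hh : Measurable (Function.uncurry h))
    (h1 : ∀ x, ∫⁻ y, (h x y : ℝ≥0∞) ∂(p x) = 1)
    (Pμ : Measure (ℕ → 𝒳 × ℝ))
    (HP : ∀ n : ℕ, Pμ.map (fun ω (i : Fin (n + 1)) => ω i) =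
      pathMeasure (μ.prod (expMeasure lam)) (jumpKernel lam p) n) (t : ℝ) (n : ℕ) :
    ∫⁻ ω, ENNReal.ofReal (klFun (auxg f0 h t (n + 1) ω)) ∂Pμ
      = ∫⁻ ω, ENNReal.ofReal (klFun (auxg f0 h t n ω)) ∂Pμ
        + ∫⁻ ω, auxg f0 h t n ω * ((Set.Iic t).indicator 1 (jumpTime (n + 1) ω)
          * ∫⁻ y, ENNReal.ofReal (klFun (h (ω n).1 y)) ∂(p (ω n).1)) ∂Pμ := by
  have := isProbabilityMeasure_expMeasure hlam
  have hm : ∀ n, Measurable (fun ω => ENNReal.ofReal (klFun (auxg f0 h t n ω))) := fun n =>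
    (measurable_klFun.comp (auxg_meas f0 h hf0m hh t n).coe_nnreal_real).ennreal_ofReal
  rw [← lintegral_add_left (hm n), aux_jmarkov lam hlam _ p Pμ HP n _ (hm (n + 1))
    (fun ω ω' h' => by rw [auxg_congr f0 h t (n + 1) ω ω' h'])]
  refine lintegral_congr fun ω => ?_
  simp only [auxg_update, lintegral_const, measure_univ, mul_one]
  by_cases hJ : jumpTime (n + 1) ω ≤ t
  · rw [Set.indicator_of_mem (show _ ∈ Set.Iic t from hJ)]
    simp only [hJ, if_true, Pi.one_apply, one_mul]
    exact aux_kl_one _ _ (hh.comp (f := fun y => ((ω n).1, y)) (by fun_prop)) (h1 _) _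
  · rw [Set.indicator_of_notMem (show _ ∉ Set.Iic t from hJ)]
    simp [hJ]

lemma aux_mono {𝒳 : Type*} (ω : ℕ → 𝒳 × ℝ) (hp : ∀ k, 0 < (ω k).2) :
    StrictMono (fun n => jumpTime n ω) := by
  refine strictMono_nat_of_lt_succ fun n => ?_
  rw [aux_jumpTime_succ]
  linarith [hp n]

lemma aux_sSup {𝒳 : Type*} (ω : ℕ → 𝒳 × ℝ) (hp : ∀ k, 0 < (ω k).2) (s : ℝ) (n : ℕ)
    (h1 : jumpTime n ω ≤ s) (h2 : s < jumpTime (n + 1) ω) :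
    sSup {m : ℕ | jumpTime m ω ≤ s} = n := by
  have : {m : ℕ | jumpTime m ω ≤ s} = Set.Iic n := by
    ext m
    simp only [Set.mem_setOf_eq, Set.mem_Iic]
    refine ⟨fun h => ?_, fun h => ((aux_mono ω hp).monotone h).trans h1⟩
    by_contra hc
    exact absurd (((aux_mono ω hp).monotone (show n + 1 ≤ m by omega)).trans h) (not_le.2 h2)
  rw [this, csSup_Iic]

lemma auxg_eq_auxf {𝒳 : Type*} (f0 : 𝒳 → NNReal) (h : 𝒳 → 𝒳 → NNReal) (t : ℝ)
    (ω : ℕ → 𝒳 × ℝ) (hp : ∀ k, 0 < (ω k).2) (n : ℕ) (h1 : jumpTime n ω ≤ t) :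
    auxg f0 h t n ω = auxf f0 h n ω := by
  unfold auxg auxf
  congr 1
  refine Finset.prod_congr rfl fun k hk => ?_
  rw [Finset.mem_range] at hk
  rw [if_pos (((aux_mono ω hp).monotone (show k + 1 ≤ n by omega)).trans h1)]

lemma auxg_stable {𝒳 : Type*} (f0 : 𝒳 → NNReal) (h : 𝒳 → 𝒳 → NNReal) (t : ℝ)
    (ω : ℕ → 𝒳 × ℝ) (hp : ∀ k, 0 < (ω k).2) (n : ℕ) (h2 : t < jumpTime (n + 1) ω) (m : ℕ)
    (hm : n ≤ m) : auxg f0 h t m ω = auxg f0 h t n ω := by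
  induction m, hm using Nat.le_induction with
  | base => rfl
  | succ m hm ih =>
    rw [← ih]
    unfold auxg
    rw [Finset.prod_range_succ, if_neg, mul_one]
    exact not_le.2 (h2.trans_le ((aux_mono ω hp).monotone (by omega)))

lemma aux_exists {𝒳 : Type*} (t : ℝ) (ht : 0 ≤ t) (ω : ℕ → 𝒳 × ℝ)
    (hf : ∃ n, t < jumpTime (n + 1) ω) :
    ∃ n, jumpTime n ω ≤ t ∧ t < jumpTime (n + 1) ω := by
  refine ⟨Nat.find hf, ?_, Nat.find_spec hf⟩
  rcases Nat.eq_zero_or_pos (Nat.find hf) with h0 | h0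
  · rw [h0]
    simpa [jumpTime] using ht
  · have := Nat.find_min hf (show Nat.find hf - 1 < Nat.find hf by omega)
    rw [Nat.sub_add_cancel h0] at this
    exact not_lt.1 this

/-- path frozen after step `n` -/
def auxTrunc {𝒳 : Type*} (n : ℕ) (ω : ℕ → 𝒳 × ℝ) : ℕ → 𝒳 × ℝ :=
  fun k => if k ≤ n then ω k else ((ω n).1, 1)

lemma aux_meas_trunc (n : ℕ) : Measurable (auxTrunc n : (ℕ → 𝒳 × ℝ) → ℕ → 𝒳 × ℝ) := by
  refine measurable_pi_iff.2 fun k => ?_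
  unfold auxTrunc
  by_cases hk : k ≤ n
  · simp only [hk, if_true]
    fun_prop
  · simp only [hk, if_false]
    fun_prop

lemma aux_trunc_proc {𝒳 : Type*} (t : ℝ) (ω : ℕ → 𝒳 × ℝ) (hp : ∀ k, 0 < (ω k).2) (n : ℕ)
    (h2 : t < jumpTime (n + 1) ω) (s : ℝ) (hs : s ≤ t) :
    jumpProc s (auxTrunc n ω) = jumpProc s ω := by
  have hp' : ∀ k, 0 < (auxTrunc n ω k).2 := by
    intro k
    unfold auxTrunc
    split_ifs
    · exact hp k
    · exact one_pos
  have hJ : ∀ m ≤ n + 1, jumpTime m (auxTrunc n ω) = jumpTime m ω := fun m hm =>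
    aux_jumpTime_congr _ _ _ fun i hi => by
      unfold auxTrunc
      rw [if_pos (by omega)]
  have hset : {m : ℕ | jumpTime m (auxTrunc n ω) ≤ s} = {m : ℕ | jumpTime m ω ≤ s} := by
    ext m
    simp only [Set.mem_setOf_eq]
    rcases le_or_gt m (n + 1) with hm | hm
    · rw [hJ m hm]
    · have a1 := (aux_mono ω hp).monotone hm.le
      have a2 := (aux_mono _ hp').monotone hm.le
      simp only [hJ _ le_rfl] at a1 a2
      constructor <;> intro _ <;> linarith
  have hle : sSup {m : ℕ | jumpTime m ω ≤ s} ≤ n := by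
    refine csSup_le' fun m hm => ?_
    by_contra hc
    have := (aux_mono ω hp).monotone (show n + 1 ≤ m by omega)
    simp only [Set.mem_setOf_eq] at hm this
    linarith
  unfold jumpProc
  rw [hset]
  unfold auxTrunc
  rw [if_pos hle]

lemma aux_meas_N (s : ℝ) :
    Measurable (fun ω : ℕ → 𝒳 × ℝ => sSup {m : ℕ | jumpTime m ω ≤ s}) := by
  have hm : ∀ m, MeasurableSet {ω : ℕ → 𝒳 × ℝ | jumpTime m ω ≤ s} := fun m =>
    measurableSet_le (aux_meas_jumpTime _) measurable_const
  have hG : ∀ k, MeasurableSet {ω : ℕ → 𝒳 × ℝ | IsGreatest {m : ℕ | jumpTime m ω ≤ s} k} := by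
    intro k
    have : {ω : ℕ → 𝒳 × ℝ | IsGreatest {m : ℕ | jumpTime m ω ≤ s} k}
        = {ω | jumpTime k ω ≤ s} ∩ ⋂ m, ⋂ (_ : k < m), {ω | jumpTime m ω ≤ s}ᶜ := by
      ext ω
      simp only [IsGreatest, upperBounds, Set.mem_setOf_eq, Set.mem_inter_iff, Set.mem_iInter,
        Set.mem_compl_iff]
      refine and_congr_right fun _ => ⟨fun h m hm hc => ?_, fun h m hm => ?_⟩
      · exact absurd (h hc) (not_le.2 hm)
      · by_contra hc
        exact h m (not_le.1 hc) hm
    rw [this]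
    exact (hm k).inter (MeasurableSet.iInter fun m => MeasurableSet.iInter fun _ => (hm m).compl)
  have hno : ∀ ω : ℕ → 𝒳 × ℝ, (¬ ∃ k, IsGreatest {m : ℕ | jumpTime m ω ≤ s} k) →
      sSup {m : ℕ | jumpTime m ω ≤ s} = 0 := by
    intro ω hω
    rcases Set.eq_empty_or_nonempty {m : ℕ | jumpTime m ω ≤ s} with he | he
    · rw [he]
      simp
    · by_cases hb : BddAbove {m : ℕ | jumpTime m ω ≤ s}
      · exact absurd ⟨_, Nat.sSup_mem he hb, fun m hm => le_csSup hb hm⟩ hω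
      · exact Nat.sSup_of_not_bddAbove hb
  refine measurable_to_countable' fun k => ?_
  have : (fun ω : ℕ → 𝒳 × ℝ => sSup {m : ℕ | jumpTime m ω ≤ s}) ⁻¹' {k}
      = {ω | IsGreatest {m : ℕ | jumpTime m ω ≤ s} k} ∪
        ({_ω | k = 0} ∩ (⋃ j, {ω | IsGreatest {m : ℕ | jumpTime m ω ≤ s} j})ᶜ) := by
    ext ω
    simp only [Set.mem_preimage, Set.mem_singleton_iff, Set.mem_union, Set.mem_setOf_eq,
      Set.mem_inter_iff, Set.mem_compl_iff, Set.mem_iUnion]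
    constructor
    · intro h
      by_cases hex : ∃ j, IsGreatest {m : ℕ | jumpTime m ω ≤ s} j
      · obtain ⟨j, hj⟩ := hex
        rw [hj.csSup_eq] at h
        exact Or.inl (h ▸ hj)
      · exact Or.inr ⟨by rw [← h, hno ω hex], hex⟩
    · rintro (h | ⟨h, hex⟩)
      · exact h.csSup_eq
      · rw [hno ω hex, h]
  rw [this]
  exact (hG k).union ((MeasurableSet.const _).inter (MeasurableSet.iUnion fun j => hG j).compl)

lemma aux_meas_proc (s : ℝ) : Measurable (fun ω : ℕ → 𝒳 × ℝ => jumpProc s ω) := by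
  have h1 : Measurable (fun q : (ℕ → 𝒳 × ℝ) × ℕ => (q.1 q.2).1) :=
    measurable_from_prod_countable_left fun n => by fun_prop
  exact h1.comp (measurable_id.prodMk (aux_meas_N s))

lemma aux_meas_D (f0 : 𝒳 → NNReal) (h : 𝒳 → 𝒳 → NNReal) (hf0m : Measurable f0)
    (hh : Measurable (Function.uncurry h)) (t : ℝ) :
    Measurable (fun ω : ℕ → 𝒳 × ℝ => auxg f0 h t (sSup {m : ℕ | jumpTime m ω ≤ t}) ω) := by
  have h1 : Measurable (fun q : (ℕ → 𝒳 × ℝ) × ℕ => auxg f0 h t q.2 q.1) :=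
    measurable_from_prod_countable_left fun n => auxg_meas f0 h hf0m hh t n
  exact h1.comp (measurable_id.prodMk (aux_meas_N t))


lemma aux_density [MeasurableSpace.CountablyGenerated 𝒳] (mustar : Measure 𝒳)
    (p ptilde : Kernel 𝒳 𝒳) [IsMarkovKernel p] [IsMarkovKernel ptilde]
    (hkac : ∀ᵐ x ∂mustar, ptilde x ≪ p x) :
    ∃ h : 𝒳 → 𝒳 → NNReal, Measurable (Function.uncurry h) ∧
      (∀ x, ∫⁻ y, (h x y : ℝ≥0∞) ∂(p x) = 1) ∧
      ∀ᵐ x ∂mustar, ptilde x = (p x).withDensity (fun y => (h x y : ℝ≥0∞)) := by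
  have key : ∀ x, ptilde x ≪ p x →
      ptilde x = (p x).withDensity (fun y => ((Kernel.rnDeriv ptilde p x y).toNNReal : ℝ≥0∞)) := by
    intro x hx
    have e := Kernel.withDensity_rnDeriv_eq hx
    rw [Kernel.withDensity_apply _ (Kernel.measurable_rnDeriv _ _)] at e
    conv_lhs => rw [← e]
    refine withDensity_congr_ae ?_
    filter_upwards [Kernel.rnDeriv_ne_top ptilde p (a := x)] with y hy
    exact (ENNReal.coe_toNNReal hy).symm
  refine ⟨fun x y => if ptilde x ≪ p x then (Kernel.rnDeriv ptilde p x y).toNNReal else 1,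
    ?_, ?_, ?_⟩
  · exact Measurable.ite (measurable_fst (Kernel.measurableSet_absolutelyContinuous ptilde p))
      (Kernel.measurable_rnDeriv ptilde p).ennreal_toNNReal measurable_const
  · intro x
    by_cases hx : ptilde x ≪ p x
    · simp only [hx, if_true]
      have := congrArg (fun m : Measure 𝒳 => m Set.univ) (key x hx)
      simp only [measure_univ, withDensity_apply _ MeasurableSet.univ,
        Measure.restrict_univ] at this
      exact this.symm
    · simp [hx]
  · filter_upwards [hkac] with x hx
    simp only [hx, if_true]
    exact key x hx

lemma aux_hnu (mustar : Measure 𝒳) (ptilde : Kernel 𝒳 𝒳)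
    (hinv : mustar.bind (fun x => ptilde x) = mustar) (n : ℕ) :
    auxNu mustar ptilde n = mustar := by
  induction n with
  | zero => rfl
  | succ n ih => rw [auxNu, ih, hinv]

open InformationTheory in
lemma aux_kl_bound (f0 : 𝒳 → NNReal) (h : 𝒳 → 𝒳 → NNReal) (lam : ℝ) (hlam : 0 < lam)
    (μ mustar : Measure 𝒳) [IsProbabilityMeasure μ]
    [IsProbabilityMeasure mustar] (p ptilde : Kernel 𝒳 𝒳) [IsMarkovKernel p]
    [IsMarkovKernel ptilde]
    (hf0m : Measurable f0) (hh : Measurable (Function.uncurry h))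
    (h1 : ∀ x, ∫⁻ y, (h x y : ℝ≥0∞) ∂(p x) = 1)
    (hf0 : mustar = μ.withDensity (fun x => (f0 x : ℝ≥0∞)))
    (hae : ∀ᵐ x ∂mustar, ptilde x = (p x).withDensity (fun y => (h x y : ℝ≥0∞)))
    (hnu : ∀ n, auxNu mustar ptilde n = mustar)
    (Pμ Pmustar : Measure (ℕ → 𝒳 × ℝ))
    (HP : ∀ n : ℕ, Pμ.map (fun ω (i : Fin (n + 1)) => ω i) =
      pathMeasure (μ.prod (expMeasure lam)) (jumpKernel lam p) n)
    (HPt : ∀ n : ℕ, Pmustar.map (fun ω (i : Fin (n + 1)) => ω i) =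
      pathMeasure (mustar.prod (expMeasure lam)) (jumpKernel lam ptilde) n) (t : ℝ) (n : ℕ) :
    ∫⁻ ω, ENNReal.ofReal (klFun (auxg f0 h t n ω)) ∂Pμ
      = relEnt mustar μ + ∑ k ∈ Finset.range n, auxM lam k (Set.Iic t)
        * ∫⁻ x, relEnt (ptilde x) (p x) ∂mustar := by
  have := isProbabilityMeasure_expMeasure hlam
  have hRm : Measurable (fun x => ∫⁻ y, ENNReal.ofReal (klFun (h x y)) ∂(p x)) :=
    Measurable.lintegral_kernel_prod_right'
      (f := fun q : 𝒳 × 𝒳 => ENNReal.ofReal (klFun (h q.1 q.2)))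
      (measurable_klFun.comp hh.coe_nnreal_real).ennreal_ofReal
  have hR : ∫⁻ x, relEnt (ptilde x) (p x) ∂mustar
      = ∫⁻ x, ∫⁻ y, ENNReal.ofReal (klFun (h x y)) ∂(p x) ∂mustar := by
    refine lintegral_congr_ae ?_
    filter_upwards [hae] with x hx
    rw [aux_relEnt_eq]
    exact aux_kl_wd _ _ _ (hh.comp (f := fun y => (x, y)) (by fun_prop)) hx
  induction n with
  | zero =>
    have hm : Measurable (fun ω => ENNReal.ofReal (klFun (auxg f0 h t 0 ω))) :=
      (measurable_klFun.comp (auxg_meas f0 h hf0m hh t 0).coe_nnreal_real).ennreal_ofReal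
    rw [aux_init _ _ Pμ HP _ hm (fun ω ω' h' => by rw [auxg_congr f0 h t 0 ω ω' h'])]
    have hm2 : Measurable (fun x : 𝒳 × ℝ => ENNReal.ofReal (klFun (f0 x.1))) :=
      (measurable_klFun.comp (hf0m.comp measurable_fst).coe_nnreal_real).ennreal_ofReal
    simp only [auxg, Finset.range_zero, Finset.prod_empty, mul_one, Finset.sum_empty, add_zero]
    rw [lintegral_prod _ hm2.aemeasurable, aux_relEnt_eq, aux_kl_wd mustar μ f0 hf0m hf0]
    simp
  | succ n ih =>
    rw [aux_kl_step f0 h lam hlam μ p hf0m hh h1 Pμ HP t n, ih, Finset.sum_range_succ, add_assoc]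
    congr 2
    have hI : Measurable ((Set.Iic t).indicator (1 : ℝ → ℝ≥0∞)) :=
      measurable_one.indicator measurableSet_Iic
    have e1 : ∫⁻ ω, auxg f0 h t n ω * ((Set.Iic t).indicator 1 (jumpTime (n + 1) ω)
          * ∫⁻ y, ENNReal.ofReal (klFun (h (ω n).1 y)) ∂(p (ω n).1)) ∂Pμ
        = ∫⁻ ω, auxf f0 h n ω * ((Set.Iic t).indicator 1 (jumpTime (n + 1) ω)
          * ∫⁻ y, ENNReal.ofReal (klFun (h (ω n).1 y)) ∂(p (ω n).1)) ∂Pμ := by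
      refine lintegral_congr_ae ?_
      filter_upwards [aux_pos lam hlam μ p Pμ HP] with ω hp
      by_cases hJ : jumpTime (n + 1) ω ≤ t
      · rw [auxg_eq_auxf f0 h t ω hp n (((aux_mono ω hp).monotone (Nat.le_succ n)).trans hJ)]
      · rw [Set.indicator_of_notMem (show _ ∉ Set.Iic t from hJ)]
        simp
    rw [e1, ← aux_change f0 h lam hlam μ mustar p ptilde hf0m hh hf0 hae hnu Pμ Pmustar HP HPt n
      (fun ω => (Set.Iic t).indicator 1 (jumpTime (n + 1) ω)
          * ∫⁻ y, ENNReal.ofReal (klFun (h (ω n).1 y)) ∂(p (ω n).1)),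
      aux_law lam hlam mustar ptilde Pmustar HPt n _ _ hI hRm, hnu,
      lintegral_indicator_one measurableSet_Iic, hR]
    · exact (hI.comp (aux_meas_jumpTime (n + 1))).mul
        (hRm.comp (measurable_fst.comp (measurable_pi_apply n)))
    · intro ω ω' h'
      rw [aux_jumpTime_congr (n + 1) ω ω' (fun i hi => h' i (by omega)), h' n le_rfl]

lemma aux_map_eq (f0 : 𝒳 → NNReal) (h : 𝒳 → 𝒳 → NNReal) (lam : ℝ) (hlam : 0 < lam)
    (μ mustar : Measure 𝒳) [IsProbabilityMeasure μ]
    [IsProbabilityMeasure mustar] (p ptilde : Kernel 𝒳 𝒳) [IsMarkovKernel p]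
    [IsMarkovKernel ptilde]
    (hf0m : Measurable f0) (hh : Measurable (Function.uncurry h))
    (hf0 : mustar = μ.withDensity (fun x => (f0 x : ℝ≥0∞)))
    (hae : ∀ᵐ x ∂mustar, ptilde x = (p x).withDensity (fun y => (h x y : ℝ≥0∞)))
    (hnu : ∀ n, auxNu mustar ptilde n = mustar)
    (Pμ Pmustar : Measure (ℕ → 𝒳 × ℝ))
    (HP : ∀ n : ℕ, Pμ.map (fun ω (i : Fin (n + 1)) => ω i) =
      pathMeasure (μ.prod (expMeasure lam)) (jumpKernel lam p) n)
    (HPt : ∀ n : ℕ, Pmustar.map (fun ω (i : Fin (n + 1)) => ω i) =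
      pathMeasure (mustar.prod (expMeasure lam)) (jumpKernel lam ptilde) n) (t : ℝ) (ht : 0 ≤ t)
    (hΦ : Measurable (fun (ω : ℕ → 𝒳 × ℝ) (s : Set.Icc (0 : ℝ) t) => jumpProc (s : ℝ) ω)) :
    (Pμ.withDensity (fun ω => (auxg f0 h t (sSup {m : ℕ | jumpTime m ω ≤ t}) ω : ℝ≥0∞))).map
        (fun ω (s : Set.Icc (0 : ℝ) t) => jumpProc (s : ℝ) ω)
      = Pmustar.map (fun ω (s : Set.Icc (0 : ℝ) t) => jumpProc (s : ℝ) ω) := by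
  set Φ := fun (ω : ℕ → 𝒳 × ℝ) (s : Set.Icc (0 : ℝ) t) => jumpProc (s : ℝ) ω with hΦd
  ext B hB
  rw [Measure.map_apply hΦ hB, Measure.map_apply hΦ hB, withDensity_apply _ (hΦ hB),
    ← lintegral_indicator (hΦ hB), ← lintegral_indicator_one (hΦ hB)]
  let A : ℕ → Set (ℕ → 𝒳 × ℝ) := fun n =>
    {ω | jumpTime n ω ≤ t ∧ t < jumpTime (n + 1) ω ∧ Φ (auxTrunc n ω) ∈ B}
  have hA : ∀ n, MeasurableSet (A n) := fun n =>
    (measurableSet_le (aux_meas_jumpTime _) measurable_const).inter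
      ((measurableSet_lt measurable_const (aux_meas_jumpTime _)).inter
        ((hΦ.comp (aux_meas_trunc n)) hB))
  have hFm : ∀ n, Measurable ((A n).indicator (1 : (ℕ → 𝒳 × ℝ) → ℝ≥0∞)) := fun n =>
    measurable_one.indicator (hA n)
  have hfm : ∀ n, Measurable (fun ω => (auxf f0 h n ω : ℝ≥0∞)) := fun n =>
    (auxf_meas f0 h hf0m hh n).coe_nnreal_ennreal
  have hgood : ∀ ω : ℕ → 𝒳 × ℝ, (∀ k, 0 < (ω k).2) → (∃ n, t < jumpTime (n + 1) ω) →
      ∃ n, (sSup {m : ℕ | jumpTime m ω ≤ t} = n ∧ jumpTime n ω ≤ t) ∧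
        (∀ m, m ≠ n → ω ∉ A m) ∧ (ω ∈ A n ↔ ω ∈ Φ ⁻¹' B) := by
    intro ω hp hf
    obtain ⟨n, a1, a2⟩ := aux_exists t ht ω hf
    refine ⟨n, ⟨aux_sSup ω hp t n a1 a2, a1⟩, ?_, ?_⟩
    · intro m hm hmem
      exact hm ((aux_sSup ω hp t m hmem.1 hmem.2.1).symm.trans (aux_sSup ω hp t n a1 a2))
    · have e : Φ (auxTrunc n ω) = Φ ω := by
        funext s
        exact aux_trunc_proc t ω hp n a2 s s.2.2
      constructor
      · intro hm
        have := hm.2.2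
        rwa [e] at this
      · intro hm
        exact ⟨a1, a2, by rw [e]; exact hm⟩
  have s1 : ∫⁻ ω, (Φ ⁻¹' B).indicator 1 ω ∂Pmustar
      = ∑' n, ∫⁻ ω, (A n).indicator 1 ω ∂Pmustar := by
    rw [← lintegral_tsum fun n => (hFm n).aemeasurable]
    refine lintegral_congr_ae ?_
    filter_upwards [aux_pos lam hlam mustar ptilde Pmustar HPt,
      aux_finite lam hlam mustar ptilde Pmustar HPt t] with ω hp hf
    obtain ⟨n, -, b1, b2⟩ := hgood ω hp hf
    rw [tsum_eq_single n fun m hm => Set.indicator_of_notMem (b1 m hm) _]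
    by_cases hm : ω ∈ A n
    · rw [Set.indicator_of_mem hm, Set.indicator_of_mem (b2.1 hm)]
    · rw [Set.indicator_of_notMem hm, Set.indicator_of_notMem (fun hc => hm (b2.2 hc))]
  have s2 : ∫⁻ ω, (Φ ⁻¹' B).indicator
        (fun ω => (auxg f0 h t (sSup {m : ℕ | jumpTime m ω ≤ t}) ω : ℝ≥0∞)) ω ∂Pμ
      = ∑' n, ∫⁻ ω, auxf f0 h n ω * (A n).indicator 1 ω ∂Pμ := by
    have hmm : ∀ n, Measurable (fun ω => (auxf f0 h n ω : ℝ≥0∞)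
        * (A n).indicator (1 : (ℕ → 𝒳 × ℝ) → ℝ≥0∞) ω) := fun n => (hfm n).mul (hFm n)
    rw [← lintegral_tsum fun n => (hmm n).aemeasurable]
    refine lintegral_congr_ae ?_
    filter_upwards [aux_pos lam hlam μ p Pμ HP,
      aux_finite lam hlam μ p Pμ HP t] with ω hp hf
    obtain ⟨n, ⟨b0, b0'⟩, b1, b2⟩ := hgood ω hp hf
    rw [tsum_eq_single n fun m hm => by rw [Set.indicator_of_notMem (b1 m hm), mul_zero]]
    by_cases hm : ω ∈ A n
    · rw [Set.indicator_of_mem hm, Set.indicator_of_mem (b2.1 hm), b0,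
        auxg_eq_auxf f0 h t ω hp n b0', Pi.one_apply, mul_one]
    · rw [Set.indicator_of_notMem hm, Set.indicator_of_notMem (fun hc => hm (b2.2 hc)), mul_zero]
  rw [s1, s2]
  refine tsum_congr fun n => ?_
  refine (aux_change f0 h lam hlam μ mustar p ptilde hf0m hh hf0 hae hnu Pμ Pmustar HP HPt n
    _ (hFm n) ?_).symm
  intro ω ω' h'
  have t1 : auxTrunc n ω = auxTrunc n ω' := by
    funext k
    unfold auxTrunc
    split_ifs with hk
    · exact h' k hk
    · rw [h' n le_rfl]
  have hiff : ω ∈ A n ↔ ω' ∈ A n := by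
    simp only [A, Set.mem_setOf_eq]
    rw [t1, aux_jumpTime_congr n ω ω' (fun i hi => h' i (by omega)),
      aux_jumpTime_congr (n + 1) ω ω' (fun i hi => h' i (by omega))]
  by_cases hm : ω ∈ A n
  · rw [Set.indicator_of_mem hm, Set.indicator_of_mem (hiff.1 hm)]
    rfl
  · rw [Set.indicator_of_notMem hm, Set.indicator_of_notMem (fun hc => hm (hiff.2 hc))]

end JumpHelpers

/-- Relative entropy bound for jump-process path measures: with `μ̃* ` invariant for `p̃`,
`R(P̃^{μ̃*}|_{𝓕_t} ‖ P^{μ}|_{𝓕_t}) ≤ R(μ̃*‖μ) + λt ∫ R(p̃(x,·)‖p(x,·)) dμ̃*(x)`,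
where the restriction to `𝓕_t = σ(X_s : s ≤ t)` is realized by pushing forward along
`ω ↦ (X_s(ω))_{s ∈ [0,t]}`. -/
theorem jump_process_relative_entropy_bound {𝒳 : Type*} [MeasurableSpace 𝒳]
    [TopologicalSpace 𝒳] [PolishSpace 𝒳] [BorelSpace 𝒳]
    (lam : ℝ) (hlam : 0 < lam) (t : ℝ) (ht : 0 ≤ t)
    (μ mustar : Measure 𝒳) [IsProbabilityMeasure μ] [IsProbabilityMeasure mustar]
    (p ptilde : Kernel 𝒳 𝒳) [IsMarkovKernel p] [IsMarkovKernel ptilde]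
    (hac : mustar ≪ μ)
    (hkac : ∀ᵐ x ∂mustar, ptilde x ≪ p x)
    (hinv : mustar.bind (fun x => ptilde x) = mustar)
    (Pμ Pmustar : Measure (ℕ → 𝒳 × ℝ))
    [IsProbabilityMeasure Pμ] [IsProbabilityMeasure Pmustar]
    (HP : ∀ n : ℕ, Pμ.map (fun ω (i : Fin (n + 1)) => ω i) =
      pathMeasure (μ.prod (ProbabilityTheory.expMeasure lam)) (jumpKernel lam p) n)
    (HPt : ∀ n : ℕ, Pmustar.map (fun ω (i : Fin (n + 1)) => ω i) =
      pathMeasure (mustar.prod (ProbabilityTheory.expMeasure lam)) (jumpKernel lam ptilde) n) :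
    relEnt (Pmustar.map (fun ω (s : Set.Icc (0 : ℝ) t) => jumpProc (s : ℝ) ω))
        (Pμ.map (fun ω (s : Set.Icc (0 : ℝ) t) => jumpProc (s : ℝ) ω)) ≤
      relEnt mustar μ +
        ENNReal.ofReal (lam * t) * ∫⁻ x, relEnt (ptilde x) (p x) ∂mustar := by
  obtain ⟨h, hh, h1, hae⟩ := aux_density mustar p ptilde hkac
  have hnu := aux_hnu mustar ptilde hinv
  set f0 : 𝒳 → NNReal := fun x => (mustar.rnDeriv μ x).toNNReal with hf0d
  have hf0m : Measurable f0 := (Measure.measurable_rnDeriv _ _).ennreal_toNNReal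
  have hf0 : mustar = μ.withDensity (fun x => (f0 x : ℝ≥0∞)) := by
    conv_lhs => rw [← Measure.withDensity_rnDeriv_eq mustar μ hac]
    refine withDensity_congr_ae ?_
    filter_upwards [Measure.rnDeriv_ne_top mustar μ] with x hx
    exact (ENNReal.coe_toNNReal hx).symm
  have hΦ : Measurable (fun (ω : ℕ → 𝒳 × ℝ) (s : Set.Icc (0 : ℝ) t) => jumpProc (s : ℝ) ω) :=
    measurable_pi_iff.2 fun s => aux_meas_proc _
  have hmap := aux_map_eq f0 h lam hlam μ mustar p ptilde hf0m hh hf0 hae hnu Pμ Pmustar HP HPt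
    t ht hΦ
  have hDm := aux_meas_D f0 h hf0m hh t
  have hp1 : IsProbabilityMeasure
      (Pmustar.map (fun ω (s : Set.Icc (0 : ℝ) t) => jumpProc (s : ℝ) ω)) :=
    Measure.isProbabilityMeasure_map hΦ.aemeasurable
  have hp2 : IsProbabilityMeasure
      (Pμ.map (fun ω (s : Set.Icc (0 : ℝ) t) => jumpProc (s : ℝ) ω)) :=
    Measure.isProbabilityMeasure_map hΦ.aemeasurable
  set Q := Pμ.withDensity
    (fun ω => (auxg f0 h t (sSup {m : ℕ | jumpTime m ω ≤ t}) ω : ℝ≥0∞)) with hQ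
  have hQf : IsFiniteMeasure Q := by
    constructor
    have e := congrArg (fun m => m Set.univ) hmap
    simp only [measure_univ] at e
    rw [Measure.map_apply hΦ MeasurableSet.univ, Set.preimage_univ] at e
    rw [e]
    exact ENNReal.one_lt_top
  rw [aux_relEnt_eq (Pmustar.map _), ← hmap]
  refine (InformationTheory.klDiv_map_le Q Pμ hΦ).trans ?_
  rw [aux_kl_wd Q Pμ _ hDm hQ]
  have hb : ∀ n, ∫⁻ ω, ENNReal.ofReal (InformationTheory.klFun (auxg f0 h t n ω)) ∂Pμ
      ≤ relEnt mustar μ + ENNReal.ofReal (lam * t) * ∫⁻ x, relEnt (ptilde x) (p x) ∂mustar := by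
    intro n
    rw [aux_kl_bound f0 h lam hlam μ mustar p ptilde hf0m hh h1 hf0 hae hnu Pμ Pmustar HP HPt t n,
      ← Finset.sum_mul]
    gcongr
    exact aux_renewal lam hlam n t
  have hm : ∀ n, Measurable
      (fun ω => ENNReal.ofReal (InformationTheory.klFun (auxg f0 h t n ω))) := fun n =>
    (InformationTheory.measurable_klFun.comp
      (auxg_meas f0 h hf0m hh t n).coe_nnreal_real).ennreal_ofReal
  calc ∫⁻ ω, ENNReal.ofReal (InformationTheory.klFun
        (auxg f0 h t (sSup {m : ℕ | jumpTime m ω ≤ t}) ω)) ∂Pμ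
      = ∫⁻ ω, Filter.liminf (fun n =>
          ENNReal.ofReal (InformationTheory.klFun (auxg f0 h t n ω))) Filter.atTop ∂Pμ := by
        refine lintegral_congr_ae ?_
        filter_upwards [aux_pos lam hlam μ p Pμ HP,
          aux_finite lam hlam μ p Pμ HP t] with ω hp hf
        obtain ⟨n, a1, a2⟩ := aux_exists t ht ω hf
        rw [aux_sSup ω hp t n a1 a2]
        symm
        refine Filter.Tendsto.liminf_eq ?_
        refine tendsto_const_nhds.congr' ?_
        filter_upwards [Filter.eventually_ge_atTop n] with m hm
        rw [auxg_stable f0 h t ω hp n a2 m hm]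
    _ ≤ Filter.liminf (fun n => ∫⁻ ω,
          ENNReal.ofReal (InformationTheory.klFun (auxg f0 h t n ω)) ∂Pμ) Filter.atTop :=
        lintegral_liminf_le hm
    _ ≤ _ := by
        refine (Filter.liminf_le_liminf (Filter.Eventually.of_forall hb)).trans ?_
        rw [Filter.liminf_const]
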